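/- For every σ > 0, the low-power asymptotics of the average-power-constrained capacity satisfies limsup_{E → 0⁺} C(E) / ( (E/σ)·√(log(σ/E)) ) ≤ 2. -/

import Mathlib

open MeasureTheory ProbabilityTheory Real Filter Set
open scoped Classical Topology

/-- Kullback--Leibler divergence (in nats), valued in the extended reals:
`D(P ∥ R) = ∫ log (dP/dR) dP` if `P ≪ R` and the log-likelihood ratio is
`P`-integrable, and `+∞` otherwise. -/
noncomputable def klDiv {α : Type*} [MeasurableSpace α] (P R : Measure α) : EReal :=
  if P ≪ R ∧ Integrable (llr P R) P then ((∫ x, llr P R x ∂P : ℝ) : EReal) else ⊤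

/-- Joint law of `(X, Y)` where `X ~ Q` and `Y = X + Z` with `Z ~ N(0, σ²)`
independent of `X`. -/
noncomputable def jointLaw (σ : ℝ) (Q : Measure ℝ) : Measure (ℝ × ℝ) :=
  (Q.prod (gaussianReal 0 ⟨σ ^ 2, sq_nonneg σ⟩)).map (fun p => (p.1, p.1 + p.2))

/-- Mutual information `I(X;Y)` in nats: the KL divergence of the joint law of
`(X, Y)` from the product of its marginal laws. -/
noncomputable def mutualInfo (σ : ℝ) (Q : Measure ℝ) : EReal :=
  klDiv (jointLaw σ Q) (((jointLaw σ Q).map Prod.fst).prod ((jointLaw σ Q).map Prod.snd))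

/-- Capacity `C(E)` of the channel `Y = X + Z`, `Z ~ N(0, σ²)`, with only an
average-power constraint: `P(X ≥ 0) = 1` and `E[X] ≤ E`. -/
noncomputable def capacityAvg (σ E : ℝ) : EReal :=
  ⨆ Q ∈ {Q : Measure ℝ | IsProbabilityMeasure Q ∧ Q (Set.Ici 0) = 1 ∧
      ∫⁻ x, ENNReal.ofReal x ∂Q ≤ ENNReal.ofReal E}, mutualInfo σ Q


open scoped ENNReal NNReal

lemma gpdf_meas (v : ℝ≥0) : Measurable (fun p : ℝ × ℝ => gaussianPDF p.1 v p.2) := by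
  have := measurable_uncurry_gaussianPDF.comp
    (f := fun p : ℝ × ℝ => (p.1, v, p.2)) (by fun_prop)
  exact this

lemma gpdf_meas' (v : ℝ≥0) (y : ℝ) : Measurable (fun x : ℝ => gaussianPDF x v y) := by
  have := measurable_uncurry_gaussianPDF.comp
    (f := fun x : ℝ => (x, v, y)) (by fun_prop)
  exact this

noncomputable def outDens (v : ℝ≥0) (Q : Measure ℝ) (y : ℝ) : ℝ≥0∞ :=
  ∫⁻ x, gaussianPDF x v y ∂Q

lemma gpdfReal_le (x y : ℝ) (v : ℝ≥0) : gaussianPDFReal x v y ≤ (√(2 * π * v))⁻¹ := by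
  rw [gaussianPDFReal]
  have h1 : rexp (-(y - x) ^ 2 / (2 * v)) ≤ 1 := by
    rw [Real.exp_le_one_iff]
    exact div_nonpos_of_nonpos_of_nonneg (by nlinarith [sq_nonneg (y - x)]) (by positivity)
  have h2 : 0 ≤ (√(2 * π * v))⁻¹ := by positivity
  nlinarith

lemma outDens_meas (v : ℝ≥0) (Q : Measure ℝ) [SFinite Q] : Measurable (outDens v Q) :=
  (gpdf_meas v).lintegral_prod_left'

lemma outDens_ne_top (v : ℝ≥0) (Q : Measure ℝ) [IsProbabilityMeasure Q] (y : ℝ) :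
    outDens v Q y ≠ ∞ := by
  have : outDens v Q y ≤ ∫⁻ _, ENNReal.ofReal ((√(2 * π * v))⁻¹) ∂Q :=
    lintegral_mono fun x => ENNReal.ofReal_le_ofReal (gpdfReal_le x y v)
  rw [lintegral_const, measure_univ, mul_one] at this
  exact ne_top_of_le_ne_top ENNReal.ofReal_ne_top this

lemma outDens_ne_zero (v : ℝ≥0) (hv : v ≠ 0) (Q : Measure ℝ) [IsProbabilityMeasure Q] (y : ℝ) :
    outDens v Q y ≠ 0 := by
  intro h
  have hm : Measurable (fun x => gaussianPDF x v y) := gpdf_meas' v y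
  rw [outDens, lintegral_eq_zero_iff hm] at h
  have : ∀ᵐ x ∂Q, False := by
    filter_upwards [h] with x hx
    exact (gaussianPDF_pos x hv y).ne' hx
  simp at this
  exact IsProbabilityMeasure.ne_zero Q this

lemma jointLaw_def' (σ : ℝ) (v : ℝ≥0) (hvv : (v : ℝ) = σ ^ 2) (Q : Measure ℝ) :
    jointLaw σ Q = (Q.prod (gaussianReal 0 v)).map (fun p => (p.1, p.1 + p.2)) := by
  have h : v = (⟨σ ^ 2, sq_nonneg σ⟩ : {r : ℝ // 0 ≤ r}) := NNReal.eq hvv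
  subst h
  rfl

lemma shear_meas : Measurable (fun p : ℝ × ℝ => (p.1, p.1 + p.2)) := by fun_prop

lemma jointLaw_eq (σ : ℝ) (v : ℝ≥0) (hvv : (v : ℝ) = σ ^ 2) (hv : v ≠ 0)
    (Q : Measure ℝ) [IsProbabilityMeasure Q] :
    jointLaw σ Q = (Q.prod volume).withDensity (fun p => gaussianPDF p.1 v p.2) := by
  refine Measure.ext_of_lintegral _ fun φ hφ => ?_
  have h0 : Measurable (fun p : ℝ × ℝ => φ (p.1, p.1 + p.2)) := hφ.comp shear_meas
  rw [jointLaw_def' σ v hvv, lintegral_map hφ shear_meas,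
    lintegral_prod _ h0.aemeasurable,
    lintegral_withDensity_eq_lintegral_mul _ (gpdf_meas v) hφ,
    lintegral_prod _ ((gpdf_meas v).mul hφ).aemeasurable]
  refine lintegral_congr fun x => ?_
  have h2 : Measurable (fun y => φ (x, y)) := hφ.comp measurable_prodMk_left
  have h1 : ∫⁻ z, φ (x, x + z) ∂(gaussianReal 0 v) =
      ∫⁻ y, φ (x, y) ∂((gaussianReal 0 v).map (x + ·)) := by
    rw [lintegral_map h2 (by fun_prop)]
  simp only at h1 ⊢
  rw [h1, gaussianReal_map_const_add, zero_add, gaussianReal_of_var_ne_zero _ hv,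
    lintegral_withDensity_eq_lintegral_mul _ (measurable_gaussianPDF _ _)
      h2]
  rfl

lemma jointLaw_fst (σ : ℝ) (v : ℝ≥0) (hvv : (v : ℝ) = σ ^ 2) (Q : Measure ℝ) [IsProbabilityMeasure Q] :
    (jointLaw σ Q).map Prod.fst = Q := by
  rw [jointLaw_def' σ v hvv, Measure.map_map measurable_fst shear_meas]
  have : (Prod.fst ∘ fun p : ℝ × ℝ => (p.1, p.1 + p.2)) = Prod.fst := rfl
  rw [this]
  simp

lemma jointLaw_snd (σ : ℝ) (v : ℝ≥0) (hvv : (v : ℝ) = σ ^ 2) (hv : v ≠ 0)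
    (Q : Measure ℝ) [IsProbabilityMeasure Q] :
    (jointLaw σ Q).map Prod.snd = volume.withDensity (outDens v Q) := by
  refine Measure.ext_of_lintegral _ fun φ hφ => ?_
  have h0 : Measurable (fun p : ℝ × ℝ => φ p.2) := hφ.comp measurable_snd
  rw [jointLaw_eq σ v hvv hv, lintegral_map hφ measurable_snd,
    lintegral_withDensity_eq_lintegral_mul _ (gpdf_meas v) h0,
    lintegral_withDensity_eq_lintegral_mul _ (outDens_meas v Q) hφ,
    lintegral_prod_symm' _ ((gpdf_meas v).mul h0)]
  refine lintegral_congr fun y => ?_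
  have hm : Measurable (fun x => gaussianPDF x v y) := gpdf_meas' v y
  simp only [Pi.mul_apply]
  rw [lintegral_mul_const _ hm]
  rfl

lemma mutualInfo_le (σ : ℝ) (hσ : 0 < σ) (Q : Measure ℝ) [IsProbabilityMeasure Q]
    (v : ℝ≥0) (hvv : (v : ℝ) = σ ^ 2)
    (r : ℝ → ℝ) (hr : Measurable r) (hr0 : ∀ y, 0 < r y)
    (hr1 : ∫⁻ y, ENNReal.ofReal (r y) ≤ 1)
    (U : ℝ × ℝ → ℝ) (hU : Integrable U (Q.prod (gaussianReal 0 v)))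
    (hle : ∀ᵐ p ∂(Q.prod (gaussianReal 0 v)),
      Real.log (gaussianPDFReal p.1 v (p.1 + p.2)) - Real.log (r (p.1 + p.2)) ≤ U p) :
    mutualInfo σ Q ≤ ((∫ p, U p ∂(Q.prod (gaussianReal 0 v)) : ℝ) : EReal) := by
  have hv : v ≠ 0 := by
    rintro rfl
    have : (0 : ℝ) < σ ^ 2 := by positivity
    rw [← hvv] at this
    simp at this
  have hJ := jointLaw_eq σ v hvv hv Q
  have hFm := outDens_meas v Q
  have hF0 := outDens_ne_zero v hv Q
  have hFt := outDens_ne_top v Q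
  set F := outDens v Q with hF
  have hW := gpdf_meas v
  have hF2 : Measurable (fun p : ℝ × ℝ => F p.2) := hFm.comp measurable_snd
  have hAm : Measurable (fun p : ℝ × ℝ => ENNReal.ofReal (r p.2) / F p.2) :=
    (hr.comp measurable_snd).ennreal_ofReal.div hF2
  have hBm : Measurable (fun p : ℝ × ℝ => F p.2 / gaussianPDF p.1 v p.2) := hF2.div hW
  have hprod : ((jointLaw σ Q).map Prod.fst).prod ((jointLaw σ Q).map Prod.snd)
      = (Q.prod volume).withDensity (fun p => F p.2) := by
    rw [jointLaw_fst σ v hvv, jointLaw_snd σ v hvv hv, prod_withDensity_right hFm]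
  have : IsProbabilityMeasure (jointLaw σ Q) := by
    rw [jointLaw_def' σ v hvv]; exact Measure.isProbabilityMeasure_map shear_meas.aemeasurable
  rw [mutualInfo]
  set P := ((jointLaw σ Q).map Prod.fst).prod ((jointLaw σ Q).map Prod.snd) with hP
  have : IsProbabilityMeasure ((jointLaw σ Q).map Prod.fst) :=
    Measure.isProbabilityMeasure_map measurable_fst.aemeasurable
  have : IsProbabilityMeasure ((jointLaw σ Q).map Prod.snd) :=
    Measure.isProbabilityMeasure_map measurable_snd.aemeasurable
  have hgm : Measurable (fun p : ℝ × ℝ => gaussianPDF p.1 v p.2 / F p.2) := hW.div hF2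
  have hJP : jointLaw σ Q = P.withDensity (fun p => gaussianPDF p.1 v p.2 / F p.2) := by
    rw [hprod, ← withDensity_mul _ hF2 hgm, hJ]
    congr 1
    ext p
    simp only [Pi.mul_apply]
    rw [ENNReal.mul_div_cancel (hF0 _) (hFt _)]
  have hac : jointLaw σ Q ≪ P := by rw [hJP]; exact withDensity_absolutelyContinuous _ _
  have hllr : ∀ᵐ p ∂(jointLaw σ Q), llr (jointLaw σ Q) P p =
      Real.log (gaussianPDFReal p.1 v p.2) - Real.log (F p.2).toReal := by
    have h1 : (jointLaw σ Q).rnDeriv P =ᵐ[P] (fun p => gaussianPDF p.1 v p.2 / F p.2) := by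
      conv_lhs => rw [hJP]
      exact Measure.rnDeriv_withDensity _ hgm
    filter_upwards [hac.ae_le h1] with p hp
    rw [llr, hp, ENNReal.toReal_div, toReal_gaussianPDF, Real.log_div]
    · exact (gaussianPDFReal_pos _ _ _ hv).ne'
    · exact (ENNReal.toReal_pos (hF0 _) (hFt _)).ne'
  set φ : ℝ × ℝ → ℝ × ℝ := fun p => (p.1, p.1 + p.2) with hφ
  have hφm : Measurable φ := by fun_prop
  have hJφ : jointLaw σ Q = (Q.prod (gaussianReal 0 v)).map φ := jointLaw_def' σ v hvv Q
  -- the two auxiliary ratios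
  have hA : ∫⁻ p, ENNReal.ofReal (r p.2) / F p.2 ∂(jointLaw σ Q) ≤ 1 := by
    rw [hJ, lintegral_withDensity_eq_lintegral_mul _ hW hAm,
      lintegral_prod_symm' _ (hW.mul hAm)]
    refine le_trans (le_of_eq ?_) hr1
    refine lintegral_congr fun y => ?_
    have hm : Measurable (fun x => gaussianPDF x v y) := gpdf_meas' v y
    simp only [Pi.mul_apply]
    rw [lintegral_mul_const _ hm]
    change F y * _ = _
    rw [ENNReal.mul_div_cancel (hF0 _) (hFt _)]
  have hB : ∫⁻ p, F p.2 / gaussianPDF p.1 v p.2 ∂(jointLaw σ Q) ≤ 1 := by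
    rw [hJ, lintegral_withDensity_eq_lintegral_mul _ hW hBm]
    have : ∫⁻ p, F p.2 ∂(Q.prod volume) = 1 := by
      have : P univ = 1 := measure_univ
      rw [hprod, withDensity_apply _ MeasurableSet.univ] at this
      simpa using this
    rw [← this]
    refine lintegral_mono fun p => ?_
    simp only [Pi.mul_apply]
    rw [ENNReal.mul_div_cancel (gaussianPDF_pos _ hv _).ne' gaussianPDF_ne_top]
  have hAi : Integrable (fun p : ℝ × ℝ => (ENNReal.ofReal (r p.2) / F p.2).toReal) (jointLaw σ Q) :=
    integrable_toReal_of_lintegral_ne_top hAm.aemeasurable (ne_top_of_le_ne_top ENNReal.one_ne_top hA)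
  have hBi : Integrable (fun p : ℝ × ℝ => (F p.2 / gaussianPDF p.1 v p.2).toReal) (jointLaw σ Q) :=
    integrable_toReal_of_lintegral_ne_top hBm.aemeasurable (ne_top_of_le_ne_top ENNReal.one_ne_top hB)
  have hA1 : ∫ p, (ENNReal.ofReal (r p.2) / F p.2).toReal ∂(jointLaw σ Q) ≤ 1 := by
    rw [integral_toReal hAm.aemeasurable]
    · exact ENNReal.toReal_le_of_le_ofReal zero_le_one (by simpa using hA)
    · exact ae_of_all _ fun p => ENNReal.div_lt_top ENNReal.ofReal_ne_top (hF0 _)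
  -- pull back
  rw [hJφ] at hAi hBi hA1 hllr
  rw [integrable_map_measure hAi.1 hφm.aemeasurable] at hAi
  rw [integrable_map_measure hBi.1 hφm.aemeasurable] at hBi
  rw [integral_map hφm.aemeasurable hAm.ennreal_toReal.aestronglyMeasurable] at hA1
  rw [← hJφ] at hllr
  have hllr' := ae_of_ae_map hφm.aemeasurable (by rw [← hJφ]; exact hllr)
  have hub : ∀ᵐ p ∂(Q.prod (gaussianReal 0 v)), llr (jointLaw σ Q) P (φ p) ≤
      U p + ((ENNReal.ofReal (r (φ p).2) / F (φ p).2).toReal - 1) := by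
    filter_upwards [hllr', hle] with p h1 h2
    have hFp := ENNReal.toReal_pos (hF0 (φ p).2) (hFt (φ p).2)
    have h3 := Real.log_le_sub_one_of_pos (div_pos (hr0 (φ p).2) hFp)
    rw [Real.log_div (hr0 _).ne' hFp.ne'] at h3
    rw [h1, ENNReal.toReal_div, ENNReal.toReal_ofReal (hr0 _).le]
    change _ - Real.log (r (φ p).2) ≤ _ at h2
    change Real.log (gaussianPDFReal (φ p).1 v (φ p).2) - _ ≤ _ at h2
    linarith
  have hlb : ∀ᵐ p ∂(Q.prod (gaussianReal 0 v)),
      - (F (φ p).2 / gaussianPDF (φ p).1 v (φ p).2).toReal ≤ llr (jointLaw σ Q) P (φ p) := by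
    filter_upwards [hllr'] with p h1
    have hFp := ENNReal.toReal_pos (hF0 (φ p).2) (hFt (φ p).2)
    have hg := gaussianPDFReal_pos (φ p).1 v (φ p).2 hv
    have h3 := Real.log_le_sub_one_of_pos (div_pos hFp hg)
    rw [Real.log_div hFp.ne' hg.ne'] at h3
    rw [h1, ENNReal.toReal_div, toReal_gaussianPDF]
    linarith
  have hubi : Integrable (fun p => U p + ((ENNReal.ofReal (r (φ p).2) / F (φ p).2).toReal - 1))
      (Q.prod (gaussianReal 0 v)) := hU.add (hAi.sub (integrable_const 1))
  have hint' : Integrable (fun p => llr (jointLaw σ Q) P (φ p)) (Q.prod (gaussianReal 0 v)) :=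
    integrable_of_le_of_le ((measurable_llr _ _).comp hφm).aestronglyMeasurable hlb hub hBi.neg hubi
  have hint : Integrable (llr (jointLaw σ Q) P) (jointLaw σ Q) := by
    conv => arg 2; rw [hJφ]
    rw [integrable_map_measure (measurable_llr _ _).aestronglyMeasurable hφm.aemeasurable]
    exact hint'
  rw [klDiv, if_pos ⟨hac, hint⟩, EReal.coe_le_coe_iff]
  have hval : ∫ p, llr (jointLaw σ Q) P p ∂(jointLaw σ Q) =
      ∫ p, llr (jointLaw σ Q) P (φ p) ∂(Q.prod (gaussianReal 0 v)) := by
    conv_lhs => arg 1; rw [hJφ]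
    rw [integral_map hφm.aemeasurable (measurable_llr _ _).aestronglyMeasurable]
  rw [hval]
  refine (integral_mono_ae hint' hubi hub).trans ?_
  have hAi' : Integrable (fun p => (ENNReal.ofReal (r (φ p).2) / F (φ p).2).toReal)
    (Q.prod (gaussianReal 0 v)) := hAi
  have hAi'' : Integrable (fun p => (ENNReal.ofReal (r (φ p).2) / F (φ p).2).toReal - 1)
    (Q.prod (gaussianReal 0 v)) := hAi'.sub (integrable_const 1)
  rw [integral_add hU hAi'', integral_sub hAi' (integrable_const 1)]
  simp only [integral_const, probReal_univ, smul_eq_mul, one_mul]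
  linarith

lemma log_gpdf (m y : ℝ) (v : ℝ≥0) (hv : v ≠ 0) :
    Real.log (gaussianPDFReal m v y) = - Real.log (√(2 * π * v)) - (y - m) ^ 2 / (2 * v) := by
  have : (0 : ℝ) < v := by positivity
  rw [gaussianPDFReal, Real.log_mul (by positivity) (by positivity), Real.log_exp, Real.log_inv]
  ring

lemma laplace_integral (σ : ℝ) (hσ : 0 < σ) : ∫ y : ℝ, rexp (-|y| / σ) = 2 * σ := by
  have h := integral_comp_abs (f := fun y => rexp (-y / σ))
  rw [h]
  have h2 : ∫ y in Ioi (0:ℝ), rexp (-y / σ) = ∫ y in Ioi (0:ℝ), rexp ((-σ⁻¹) * y) := by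
    refine integral_congr_ae (ae_of_all _ fun y => ?_)
    simp only
    congr 1
    field_simp
  rw [h2, integral_exp_mul_Ioi (by simpa using hσ)]
  simp

noncomputable def rDens (σ p : ℝ) (v : ℝ≥0) (y : ℝ) : ℝ :=
  (1 - p) * gaussianPDFReal 0 v y + p * ((2 * σ)⁻¹ * rexp (-|y| / σ))

lemma rDens_lintegral (σ p : ℝ) (v : ℝ≥0) (hσ : 0 < σ) (hv : v ≠ 0) (hp0 : 0 < p) (hp1 : p < 1) :
    ∫⁻ y, ENNReal.ofReal (rDens σ p v y) ≤ 1 := by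
  have hL : Integrable (fun y : ℝ => rexp (-|y| / σ)) := by
    by_contra h
    have := laplace_integral σ hσ
    rw [integral_undef h] at this
    linarith
  have hG := integrable_gaussianPDFReal 0 v
  have h1 : Integrable (fun y => (1 - p) * gaussianPDFReal 0 v y) := hG.const_mul _
  have h2 : Integrable (fun y : ℝ => p * ((2 * σ)⁻¹ * rexp (-|y| / σ))) :=
    (hL.const_mul _).const_mul _
  have hI : Integrable (rDens σ p v) := h1.add h2
  rw [← ofReal_integral_eq_lintegral_ofReal hI]
  · have : ∫ y, rDens σ p v y = 1 := by
      unfold rDens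
      rw [integral_add h1 h2, integral_const_mul, integral_const_mul, integral_const_mul,
        laplace_integral σ hσ, integral_gaussianPDFReal_eq_one 0 hv]
      field_simp
      ring
    rw [this]; simp
  · refine ae_of_all _ fun y => ?_
    have := gaussianPDFReal_nonneg 0 v y
    have h3 : 0 ≤ 1 - p := by linarith
    simp only [Pi.zero_apply, rDens]
    positivity

lemma rDens_pos (σ p : ℝ) (v : ℝ≥0) (hσ : 0 < σ) (hp0 : 0 < p) (hp1 : p < 1)
    (y : ℝ) : 0 < rDens σ p v y := by
  have := gaussianPDFReal_nonneg 0 v y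
  have h3 : 0 ≤ 1 - p := by linarith
  unfold rDens
  positivity

lemma pointwise (σ s p x z : ℝ) (v : ℝ≥0) (hσ : 0 < σ) (hvv : (v : ℝ) = σ ^ 2) (hv : v ≠ 0)
    (hs : 1 ≤ s) (hp : Real.log p = - s ^ 2) (hp0 : 0 < p) (hp2 : p ≤ 1 / 2) (hx : 0 ≤ x) :
    Real.log (gaussianPDFReal x v (x + z)) - Real.log (rDens σ p v (x + z)) ≤
      2 * p + x * (((1 + (z / σ) ^ 2) / 2 + s + 1) / σ) := by
  obtain ⟨t, rfl⟩ : ∃ t, x = σ * t := ⟨x / σ, by field_simp⟩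
  obtain ⟨a, rfl⟩ : ∃ a, z = σ * a := ⟨z / σ, by field_simp⟩
  have ht : 0 ≤ t := by
    by_contra h
    push Not at h
    nlinarith
  have e1 : σ * a / σ = a := by field_simp
  have e2 : σ * t * (((1 + a ^ 2) / 2 + s + 1) / σ) = t * ((1 + a ^ 2) / 2 + s + 1) := by field_simp
  rw [e1, e2]
  have hg0 := gaussianPDFReal_pos 0 v (σ * t + σ * a) hv
  have hl0 : 0 < (2 * σ)⁻¹ * rexp (-|σ * t + σ * a| / σ) := by positivity
  have h1p : 0 < 1 - p := by linarith
  rw [log_gpdf _ _ v hv, hvv]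
  have e3 : (σ * t + σ * a - σ * t) ^ 2 / (2 * σ ^ 2) = a ^ 2 / 2 := by field_simp; ring
  rw [e3]
  have habs : |a| ≤ (1 + a ^ 2) / 2 := by
    have := sq_nonneg (|a| - 1)
    have h := sq_abs a
    nlinarith
  rcases le_total t s with hts | hts
  · have h1 : Real.log ((1 - p) * gaussianPDFReal 0 v (σ * t + σ * a)) ≤
        Real.log (rDens σ p v (σ * t + σ * a)) := by
      apply Real.log_le_log (by positivity)
      unfold rDens
      nlinarith [mul_pos hp0 hl0]
    rw [Real.log_mul h1p.ne' hg0.ne', log_gpdf _ _ v hv, hvv] at h1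
    have e4 : (σ * t + σ * a - 0) ^ 2 / (2 * σ ^ 2) = (t + a) ^ 2 / 2 := by field_simp; ring
    rw [e4] at h1
    have h2 : -(2 * p) ≤ Real.log (1 - p) := by
      refine le_trans ?_ (Real.one_sub_inv_le_log_of_pos h1p)
      rw [le_sub_iff_add_le, ← le_sub_iff_add_le', inv_le_iff_one_le_mul₀ h1p]
      nlinarith
    have h3 : a ≤ |a| := le_abs_self a
    have h4 : t * a ≤ t * ((1 + a ^ 2) / 2) := mul_le_mul_of_nonneg_left (h3.trans habs) ht
    have h5 : t * t ≤ t * s := mul_le_mul_of_nonneg_left hts ht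
    nlinarith
  · have h1 : Real.log (p * ((2 * σ)⁻¹ * rexp (-|σ * t + σ * a| / σ))) ≤
        Real.log (rDens σ p v (σ * t + σ * a)) := by
      apply Real.log_le_log (by positivity)
      unfold rDens
      nlinarith [mul_pos h1p hg0]
    rw [Real.log_mul hp0.ne' hl0.ne', Real.log_mul (by positivity) (by positivity), Real.log_exp,
      Real.log_inv, hp] at h1
    have e5 : -|σ * t + σ * a| / σ = -|t + a| := by
      rw [← mul_add, abs_mul, abs_of_pos hσ]; field_simp
    rw [e5] at h1
    have h2 : Real.log (2 * σ) ≤ Real.log (√(2 * π * σ ^ 2)) := by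
      apply Real.log_le_log (by positivity)
      apply Real.le_sqrt_of_sq_le
      nlinarith [Real.pi_gt_three, sq_nonneg σ]
    have h3 : |t + a| ≤ t + |a| := by
      have := abs_add_le t a
      rwa [abs_of_nonneg ht] at this
    have h4 : s * s ≤ t * s := mul_le_mul_of_nonneg_right hts (by linarith)
    have h5 : (1 + a ^ 2) / 2 ≤ t * ((1 + a ^ 2) / 2) :=
      le_mul_of_one_le_left (by positivity) (hs.trans hts)
    nlinarith [sq_nonneg a]

lemma mutualInfo_bound (σ E s : ℝ) (hσ : 0 < σ) (hE : 0 < E) (hE2 : E / σ ≤ 1 / 2) (hs : 4 ≤ s)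
    (hlog : Real.log (E / σ) = - s ^ 2) (Q : Measure ℝ) (hQ : IsProbabilityMeasure Q)
    (hQ0 : Q (Set.Ici 0) = 1) (hQE : ∫⁻ x, ENNReal.ofReal x ∂Q ≤ ENNReal.ofReal E) :
    mutualInfo σ Q ≤ ((2 * (E / σ * s) : ℝ) : EReal) := by
  obtain ⟨v, hvv⟩ : ∃ v : ℝ≥0, (v : ℝ) = σ ^ 2 := ⟨(σ ^ 2).toNNReal, by simp [sq_nonneg]⟩
  have hv : v ≠ 0 := by
    rintro rfl
    have : (0 : ℝ) < σ ^ 2 := by positivity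
    rw [← hvv] at this
    simp at this
  have hp0 : 0 < E / σ := by positivity
  have hx0 : ∀ᵐ x ∂Q, 0 ≤ x := by
    have := (prob_compl_eq_zero_iff (μ := Q) (measurableSet_Ici (a := (0:ℝ)))).2 hQ0
    rw [ae_iff]
    have h : {a : ℝ | ¬ 0 ≤ a} = (Ici 0)ᶜ := by ext a; simp
    rw [h]; exact this
  have hxi : Integrable (fun x : ℝ => x) Q := by
    refine ⟨by fun_prop, ?_⟩
    rw [hasFiniteIntegral_iff_ofReal hx0]
    exact lt_of_le_of_lt hQE ENNReal.ofReal_lt_top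
  have hxE : ∫ x, x ∂Q ≤ E := by
    rw [← ofReal_integral_eq_lintegral_ofReal hxi hx0] at hQE
    exact (ENNReal.ofReal_le_ofReal_iff hE.le).1 hQE
  have hz2 : ∫ z, z ^ 2 ∂(gaussianReal 0 v) = σ ^ 2 := by
    have h := variance_fun_id_gaussianReal (μ := 0) (v := v)
    rw [variance_of_integral_eq_zero (by fun_prop) (by simp)] at h
    rw [← hvv, ← h]
  have hz2i : Integrable (fun z : ℝ => z ^ 2) (gaussianReal 0 v) :=
    (memLp_id_gaussianReal (μ := 0) (v := v) 2).integrable_sq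
  have hgi : Integrable (fun z : ℝ => ((1 + (z / σ) ^ 2) / 2 + s + 1) / σ) (gaussianReal 0 v) := by
    have h : (fun z : ℝ => ((1 + (z / σ) ^ 2) / 2 + s + 1) / σ) =
      fun z : ℝ => (3 / 2 + s) / σ + (1 / (2 * σ ^ 3)) * z ^ 2 := by
      ext z; field_simp; ring
    rw [h]
    exact (integrable_const _).add (hz2i.const_mul _)
  have hg : ∫ z : ℝ, ((1 + (z / σ) ^ 2) / 2 + s + 1) / σ ∂(gaussianReal 0 v) = (s + 2) / σ := by
    have h : (fun z : ℝ => ((1 + (z / σ) ^ 2) / 2 + s + 1) / σ) =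
      fun z : ℝ => (3 / 2 + s) / σ + (1 / (2 * σ ^ 3)) * z ^ 2 := by
      ext z; field_simp; ring
    rw [h, integral_add (integrable_const _) (hz2i.const_mul _), integral_const_mul, hz2]
    simp
    field_simp
    ring
  have hUi := hxi.mul_prod hgi
  have hmain := mutualInfo_le σ hσ Q v hvv (rDens σ (E / σ) v)
    (by unfold rDens; have := measurable_gaussianPDFReal 0 v; fun_prop)
    (rDens_pos σ _ v hσ hp0 (by linarith))
    (rDens_lintegral σ _ v hσ hv hp0 (by linarith))
    (fun q => 2 * (E / σ) + q.1 * (((1 + (q.2 / σ) ^ 2) / 2 + s + 1) / σ))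
    ((integrable_const _).add hUi)
    (by
      have : ∀ᵐ q ∂(Q.prod (gaussianReal 0 v)), 0 ≤ q.1 :=
        Measure.quasiMeasurePreserving_fst.ae hx0
      filter_upwards [this] with q hq
      exact pointwise σ s (E / σ) q.1 q.2 v hσ hvv hv (by linarith) hlog hp0 hE2 hq)
  refine hmain.trans ?_
  rw [EReal.coe_le_coe_iff, integral_add (integrable_const _) hUi,
    integral_prod_mul (fun x : ℝ => x) (fun z : ℝ => ((1 + (z / σ) ^ 2) / 2 + s + 1) / σ), hg]
  simp only [integral_const, probReal_univ, smul_eq_mul, one_mul]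
  have h1 : (∫ x, x ∂Q) * ((s + 2) / σ) ≤ E * ((s + 2) / σ) :=
    mul_le_mul_of_nonneg_right hxE (by positivity)
  have h2 : E * ((s + 2) / σ) = E / σ * (s + 2) := by ring
  nlinarith

theorem capacityAvg_low_power_limsup (σ : ℝ) (hσ : 0 < σ) :
    Filter.limsup
        (fun E : ℝ => capacityAvg σ E / ((E / σ * Real.sqrt (Real.log (σ / E)) : ℝ) : EReal))
        (𝓝[>] 0) ≤ ((2 : ℝ) : EReal) := by
  refine Filter.limsup_le_of_le (by isBoundedDefault) ?_
  have hpos : 0 < σ * rexp (-16) := by positivity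
  filter_upwards [Ioo_mem_nhdsGT hpos] with E hE
  obtain ⟨hE0, hE1⟩ := hE
  have h16 : E / σ < rexp (-16) := by rw [div_lt_iff₀ hσ]; linarith
  have hp0 : 0 < E / σ := by positivity
  have hlogl : Real.log (E / σ) < -16 := by
    rwa [Real.log_lt_iff_lt_exp hp0]
  have hneg : Real.log (σ / E) = - Real.log (E / σ) := by rw [← Real.log_inv, inv_div]
  have hs : 4 ≤ √(Real.log (σ / E)) := by
    apply Real.le_sqrt_of_sq_le
    rw [hneg]; linarith
  have hsq : √(Real.log (σ / E)) ^ 2 = Real.log (σ / E) := Real.sq_sqrt (by rw [hneg]; linarith)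
  have hhalf : E / σ ≤ 1 / 2 := by
    have h1 : rexp (-16) * rexp 16 = 1 := by rw [← Real.exp_add]; simp
    have h2 := Real.add_one_le_exp (16 : ℝ)
    nlinarith [Real.exp_pos (-16)]
  set s := √(Real.log (σ / E)) with hsdef
  have hden : 0 < E / σ * s := by positivity
  rw [EReal.div_le_iff_le_mul (by exact_mod_cast hden) (EReal.coe_ne_top _)]
  have : ((E / σ * s : ℝ) : EReal) * ((2 : ℝ) : EReal) = ((2 * (E / σ * s) : ℝ) : EReal) := by
    rw [← EReal.coe_mul, mul_comm]
  rw [this, capacityAvg]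
  refine iSup₂_le fun Q hQ => ?_
  obtain ⟨h1, h2, h3⟩ := hQ
  exact mutualInfo_bound σ E s hσ hE0 hhalf hs (by rw [hsq, hneg]; ring) Q h1 h2 h3
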